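/- arXiv:2111.06758 — 7 statements merged into one kernel-verified Lean document; each statement's English description precedes it below -/
import Mathlib

section
/- Let $E$ be an Archimedean ordered vector space with order unit $u$. Then for every positive subset $M$ of $E$ with $\sup\{\|m\|_u : m \in M\} < \infty$, the majorizing seminorm $p_M$ is a monotone norm on $E_M$. -/
open scoped BigOperators

section MajorizedDefs

variable {E : Type*} [AddCommGroup E] [PartialOrder E] [Module ℝ E]

/-- `M` is a *positive subset* of the ordered vector space `E`: it is nonempty, contained in
the positive cone, and `0` does not belong to its convex hull. -/
def IsPositiveSubset (M : Set E) : Prop :=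
  M.Nonempty ∧ (∀ m ∈ M, 0 ≤ m) ∧ (0 : E) ∉ convexHull ℝ M

/-- The proper convex cone `C_M` generated by a positive subset `M`. -/
def coneGen (M : Set E) : Set E :=
  {c | ∃ (t : ℝ) (m : E), 0 ≤ t ∧ m ∈ convexHull ℝ M ∧ m ≠ 0 ∧ c = t • m}

/-- The majorized space `E_M`: all vectors `v` with `±v ≤ c` for some `c ∈ C_M`. -/
def EMaj (M : Set E) : Set E :=
  {v | ∃ c ∈ coneGen M, -v ≤ c ∧ v ≤ c}

/-- The majorizing seminorm `p_M`. -/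
noncomputable def pM (M : Set E) (v : E) : ℝ :=
  sInf {s : ℝ | ∃ (n : ℕ) (t : Fin n → ℝ) (m : Fin n → E),
    0 < n ∧ (∀ j, 0 ≤ t j) ∧ (∀ j, m j ∈ M) ∧
    (-v ≤ ∑ j, t j • m j) ∧ (v ≤ ∑ j, t j • m j) ∧ s = ∑ j, t j}

end MajorizedDefs

section MajorizingSeminorm

open scoped Pointwise

variable {E : Type*} [AddCommGroup E] [PartialOrder E] [Module ℝ E]

/-- The set of total weights whose infimum is `pM M v`. -/
def majorizingWeights (M : Set E) (v : E) : Set ℝ :=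
  {s : ℝ | ∃ (n : ℕ) (t : Fin n → ℝ) (m : Fin n → E),
    0 < n ∧ (∀ j, 0 ≤ t j) ∧ (∀ j, m j ∈ M) ∧
    (-v ≤ ∑ j, t j • m j) ∧ (v ≤ ∑ j, t j • m j) ∧ s = ∑ j, t j}

theorem pM_eq_sInf_majorizingWeights (M : Set E) (v : E) :
    pM M v = sInf (majorizingWeights M v) := rfl

theorem sum_mem_majorizingWeights {ι : Type*} [Fintype ι] [Nonempty ι] {M : Set E} {v : E}
    {t : ι → ℝ} {m : ι → E} (ht : ∀ j, 0 ≤ t j) (hm : ∀ j, m j ∈ M)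
    (hneg : -v ≤ ∑ j, t j • m j) (hpos : v ≤ ∑ j, t j • m j) :
    ∑ j, t j ∈ majorizingWeights M v := by
  let e := (Fintype.equivFin ι).symm
  have hsum : ∑ j, t (e j) • m (e j) = ∑ j, t j • m j := e.sum_comp fun j => t j • m j
  refine ⟨Fintype.card ι, t ∘ e, m ∘ e, Fintype.card_pos, fun j => ht _, fun j => hm _, ?_, ?_,
    (e.sum_comp t).symm⟩
  · simpa only [Function.comp_apply, hsum] using hneg
  · simpa only [Function.comp_apply, hsum] using hpos

theorem nonneg_of_mem_majorizingWeights {M : Set E} {v : E} {s : ℝ}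
    (hs : s ∈ majorizingWeights M v) : 0 ≤ s := by
  obtain ⟨n, t, m, -, ht, -, -, -, rfl⟩ := hs
  exact Finset.sum_nonneg fun j _ => ht j

theorem bddBelow_majorizingWeights (M : Set E) (v : E) : BddBelow (majorizingWeights M v) :=
  ⟨0, fun _ => nonneg_of_mem_majorizingWeights⟩

theorem pM_nonneg (M : Set E) (v : E) : 0 ≤ pM M v :=
  Real.sInf_nonneg fun _ => nonneg_of_mem_majorizingWeights

theorem majorizingWeights_nonempty {M : Set E} {v : E} (hv : v ∈ EMaj M) :
    (majorizingWeights M v).Nonempty := by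
  obtain ⟨_, ⟨r, x, hr, hx, -, rfl⟩, hneg, hpos⟩ := hv
  obtain ⟨ι, _, w, z, hw, hw_sum, hz, rfl⟩ := mem_convexHull_iff_exists_fintype.1 hx
  have : Nonempty ι := by
    by_contra h
    rw [not_nonempty_iff] at h
    simp at hw_sum
  have hsum : r • ∑ j, w j • z j = ∑ j, (r * w j) • z j := by
    simp only [Finset.smul_sum, mul_smul]
  rw [hsum] at hneg hpos
  exact ⟨_, sum_mem_majorizingWeights (fun j => mul_nonneg hr (hw j)) hz hneg hpos⟩

theorem majorizingWeights_neg (M : Set E) (v : E) :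
    majorizingWeights M (-v) = majorizingWeights M v := by
  ext s
  simp only [majorizingWeights, Set.mem_ofPred_eq, neg_neg, and_left_comm]

theorem pM_neg (M : Set E) (v : E) : pM M (-v) = pM M v := by
  rw [pM_eq_sInf_majorizingWeights, majorizingWeights_neg, pM_eq_sInf_majorizingWeights]

theorem pM_zero {M : Set E} (hM : M.Nonempty) : pM M 0 = 0 := by
  obtain ⟨x, hx⟩ := hM
  refine le_antisymm (csInf_le (bddBelow_majorizingWeights M 0) ?_) (pM_nonneg M 0)
  exact ⟨1, 0, fun _ => x, one_pos, fun _ => le_rfl, fun _ => hx, by simp, by simp, by simp⟩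

theorem add_mem_majorizingWeights [IsOrderedAddMonoid E] {M : Set E} {v w : E} {s r : ℝ}
    (hs : s ∈ majorizingWeights M v) (hr : r ∈ majorizingWeights M w) :
    s + r ∈ majorizingWeights M (v + w) := by
  obtain ⟨n, t, x, hn, ht, hx, hx_neg, hx_pos, rfl⟩ := hs
  obtain ⟨k, q, y, -, hq, hy, hy_neg, hy_pos, rfl⟩ := hr
  have : Nonempty (Fin n ⊕ Fin k) := ⟨.inl ⟨0, hn⟩⟩
  have h := sum_mem_majorizingWeights (M := M) (v := v + w) (t := Sum.elim t q)
    (m := Sum.elim x y) (by rintro (j | j) <;> simp [ht, hq])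
    (by rintro (j | j) <;> simp [hx, hy])
    (by simpa [neg_add, add_comm] using add_le_add hx_neg hy_neg)
    (by simpa using add_le_add hx_pos hy_pos)
  simpa using h

theorem pM_add_le [IsOrderedAddMonoid E] {M : Set E} {v w : E} (hv : v ∈ EMaj M)
    (hw : w ∈ EMaj M) : pM M (v + w) ≤ pM M v + pM M w := by
  refine le_of_forall_pos_lt_add fun ε hε => ?_
  obtain ⟨s, hs, hsε⟩ := exists_lt_of_csInf_lt (majorizingWeights_nonempty hv)
    (lt_add_of_pos_right (pM M v) (half_pos hε))
  obtain ⟨r, hr, hrε⟩ := exists_lt_of_csInf_lt (majorizingWeights_nonempty hw)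
    (lt_add_of_pos_right (pM M w) (half_pos hε))
  have h : pM M (v + w) ≤ s + r :=
    csInf_le (bddBelow_majorizingWeights M _) (add_mem_majorizingWeights hs hr)
  linarith

theorem pM_le_pM_of_nonneg_of_le [IsOrderedAddMonoid E] {M : Set E} {v w : E} (hw : w ∈ EMaj M) (hv : 0 ≤ v)
    (hvw : v ≤ w) : pM M v ≤ pM M w := by
  refine csInf_le_csInf (bddBelow_majorizingWeights M v) (majorizingWeights_nonempty hw) ?_
  rintro s ⟨n, t, m, hn, ht, hm, -, hpos, rfl⟩
  exact ⟨n, t, m, hn, ht, hm, (neg_nonpos.2 hv).trans (hv.trans (hvw.trans hpos)),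
    hvw.trans hpos, rfl⟩

variable [IsStrictOrderedModule ℝ E]

theorem mul_mem_majorizingWeights {M : Set E} {v : E} {s c : ℝ} (hc : 0 ≤ c)
    (hs : s ∈ majorizingWeights M v) : c * s ∈ majorizingWeights M (c • v) := by
  obtain ⟨n, t, m, hn, ht, hm, hneg, hpos, rfl⟩ := hs
  have hsum : ∑ j, (c * t j) • m j = c • ∑ j, t j • m j := by
    simp only [Finset.smul_sum, mul_smul]
  refine ⟨n, fun j => c * t j, m, hn, fun j => mul_nonneg hc (ht j), hm, ?_, ?_,
    Finset.mul_sum _ _ _⟩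
  · rw [hsum, ← smul_neg]
    exact smul_le_smul_of_nonneg_left hneg hc
  · rw [hsum]
    exact smul_le_smul_of_nonneg_left hpos hc

theorem majorizingWeights_smul {M : Set E} {v : E} {c : ℝ} (hc : 0 < c) :
    majorizingWeights M (c • v) = c • majorizingWeights M v := by
  ext s
  rw [Set.mem_smul_set_iff_inv_smul_mem₀ hc.ne']
  constructor
  · intro h
    simpa [smul_smul, hc.ne'] using mul_mem_majorizingWeights (inv_nonneg.2 hc.le) h
  · intro h
    simpa [hc.ne'] using mul_mem_majorizingWeights hc.le h

theorem pM_smul_of_pos {M : Set E} {v : E} {c : ℝ} (hc : 0 < c) :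
    pM M (c • v) = c * pM M v := by
  rw [pM_eq_sInf_majorizingWeights, majorizingWeights_smul hc, Real.sInf_smul_of_nonneg hc.le,
    smul_eq_mul, pM_eq_sInf_majorizingWeights]

theorem pM_smul {M : Set E} (hM : M.Nonempty) (c : ℝ) (v : E) :
    pM M (c • v) = |c| * pM M v := by
  rcases lt_trichotomy c 0 with hc | rfl | hc
  · rw [abs_of_neg hc, ← pM_smul_of_pos (neg_pos.2 hc), neg_smul, pM_neg]
  · simp [pM_zero hM]
  · rw [abs_of_pos hc, pM_smul_of_pos hc]

/-- A set that is bounded in the order-unit norm of `u` lies below a multiple of `u`. -/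
theorem exists_forall_le_smul_of_bddAbove {u : E} (hu_pos : 0 ≤ u)
    (hu_unit : ∀ v : E, ∃ t : ℝ, 0 < t ∧ v ≤ t • u) {M : Set E}
    (hbdd : BddAbove ((fun m => sInf {t : ℝ | 0 < t ∧ -m ≤ t • u ∧ m ≤ t • u}) '' M)) :
    ∃ K : ℝ, ∀ m ∈ M, m ≤ K • u := by
  obtain ⟨B, hB⟩ := hbdd
  refine ⟨B + 1, fun m hm => ?_⟩
  have hne : {t : ℝ | 0 < t ∧ -m ≤ t • u ∧ m ≤ t • u}.Nonempty := by
    obtain ⟨a, ha, hma⟩ := hu_unit m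
    obtain ⟨b, hb, hmb⟩ := hu_unit (-m)
    exact ⟨max a b, lt_max_of_lt_left ha,
      hmb.trans (smul_le_smul_of_nonneg_right (le_max_right a b) hu_pos),
      hma.trans (smul_le_smul_of_nonneg_right (le_max_left a b) hu_pos)⟩
  obtain ⟨t, ⟨-, -, hmt⟩, htB⟩ := exists_lt_of_csInf_lt hne
    ((hB (Set.mem_image_of_mem _ hm)).trans_lt (lt_add_one B))
  exact hmt.trans (smul_le_smul_of_nonneg_right htB.le hu_pos)

variable [IsOrderedAddMonoid E]

theorem le_smul_of_mem_majorizingWeights {M : Set E} {u v : E} {K s : ℝ}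
    (hK : ∀ m ∈ M, m ≤ K • u) (hs : s ∈ majorizingWeights M v) : v ≤ (s * K) • u := by
  obtain ⟨n, t, m, -, ht, hm, -, hpos, rfl⟩ := hs
  calc v ≤ ∑ j, t j • m j := hpos
    _ ≤ ∑ j, t j • K • u :=
      Finset.sum_le_sum fun j _ => smul_le_smul_of_nonneg_left (hK _ (hm j)) (ht j)
    _ = ((∑ j, t j) * K) • u := by rw [← Finset.sum_smul, mul_smul]

theorem nonpos_of_pM_eq_zero
    (harch : ∀ x y : E, 0 ≤ x → (∀ n : ℕ, n • y ≤ x) → y ≤ 0)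
    {u : E} (hu_pos : 0 ≤ u) {M : Set E} {K : ℝ} (hK : ∀ m ∈ M, m ≤ K • u) {v : E}
    (hne : (majorizingWeights M v).Nonempty) (hv : pM M v = 0) : v ≤ 0 := by
  refine harch u v hu_pos fun n => ?_
  have hD : 0 < n * |K| + 1 := by positivity
  obtain ⟨s, hs, hsD⟩ := exists_lt_of_csInf_lt hne (hv.trans_lt (inv_pos.2 hD))
  have hs_nonneg := nonneg_of_mem_majorizingWeights hs
  have hbound : n * (s * K) ≤ 1 := by
    have h := (mul_lt_mul_of_pos_right hsD hD).le
    rw [inv_mul_cancel₀ hD.ne'] at h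
    have h' : n * s * K ≤ n * s * |K| :=
      mul_le_mul_of_nonneg_left (le_abs_self K) (by positivity)
    linarith
  calc n • v = (n : ℝ) • v := (Nat.cast_smul_eq_nsmul ℝ n v).symm
    _ ≤ (n : ℝ) • (s * K) • u :=
      smul_le_smul_of_nonneg_left (le_smul_of_mem_majorizingWeights hK hs) n.cast_nonneg
    _ = (n * (s * K)) • u := smul_smul _ _ _
    _ ≤ (1 : ℝ) • u := smul_le_smul_of_nonneg_right hbound hu_pos
    _ = u := one_smul ℝ u

end MajorizingSeminorm

/-- Let `E` be an Archimedean ordered vector space with order unit `u`. Then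
for every positive subset `M` with `sup {‖m‖_u : m ∈ M} < ∞`, the majorizing seminorm `p_M`
is a monotone norm on `E_M`. -/
theorem majorizing_seminorm_norm_of_order_unit
    {E : Type*} [AddCommGroup E] [PartialOrder E] [IsOrderedAddMonoid E] [Module ℝ E]
    [IsStrictOrderedModule ℝ E]
    (harch : ∀ x y : E, 0 ≤ x → (∀ n : ℕ, n • y ≤ x) → y ≤ 0)
    (u : E) (hu_pos : 0 ≤ u) (hu_unit : ∀ v : E, ∃ t : ℝ, 0 < t ∧ v ≤ t • u)
    (M : Set E) (hM : IsPositiveSubset M)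
    (hbdd : BddAbove ((fun m => sInf {t : ℝ | 0 < t ∧ -m ≤ t • u ∧ m ≤ t • u}) '' M)) :
    (∀ v ∈ EMaj M, 0 ≤ pM M v) ∧
    (∀ v ∈ EMaj M, pM M v = 0 → v = 0) ∧
    (∀ v ∈ EMaj M, ∀ w ∈ EMaj M, pM M (v + w) ≤ pM M v + pM M w) ∧
    (∀ (c : ℝ), ∀ v ∈ EMaj M, pM M (c • v) = |c| * pM M v) ∧
    (∀ v ∈ EMaj M, ∀ w ∈ EMaj M, 0 ≤ v → v ≤ w → pM M v ≤ pM M w) := by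
  obtain ⟨K, hK⟩ := exists_forall_le_smul_of_bddAbove hu_pos hu_unit hbdd
  refine ⟨fun v _ => pM_nonneg M v, fun v hv h => ?_, fun v hv w hw => pM_add_le hv hw,
    fun c v _ => pM_smul hM.1 c v, fun v _ w hw => pM_le_pM_of_nonneg_of_le hw⟩
  have hne := majorizingWeights_nonempty hv
  refine le_antisymm (nonpos_of_pM_eq_zero harch hu_pos hK hne h) (neg_nonpos.1 ?_)
  exact nonpos_of_pM_eq_zero harch hu_pos hK (by rwa [majorizingWeights_neg])
    ((pM_neg M v).trans h)
end

section
/- Let $E$ be a Banach lattice and $M$ a positive uniformly bounded subset of $E$. Then $(E_{\overline{M}}, p_{\overline{M}})$ is a Banach lattice: $E_{\overline{M}}$ is an ideal of $E$, $p_{\overline{M}}$ is a lattice norm on it, and it is complete, i.e. every sequence $(x_k)$ in $E_{\overline{M}}$ with $\sum_{k=1}^\infty p_{\overline{M}}(x_k) < \infty$ has partial sums converging in the $p_{\overline{M}}$-norm to an element of $E_{\overline{M}}$. -/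
open scoped BigOperators

section MbarDefs

variable {E : Type*} [NormedAddCommGroup E] [Lattice E] [HasSolidNorm E] [IsOrderedAddMonoid E]
  [NormedSpace ℝ E]

/-- The set `M̅` of all sums of norm-convergent series `∑ t_j • m_j` with summable nonnegative
coefficients `t_j` and terms `m_j ∈ M`. -/
def MbarSet (M : Set E) : Set E :=
  {w | ∃ (t : ℕ → ℝ) (m : ℕ → E), (∀ j, 0 ≤ t j) ∧ (∀ j, m j ∈ M) ∧
        Summable t ∧ HasSum (fun j => t j • m j) w}

/-- The space `E_{M̅}` of vectors majorized by `M̅`. -/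
def EMbar (M : Set E) : Set E := {v | ∃ w ∈ MbarSet M, |v| ≤ w}

/-- The norm `p_{M̅}`. -/
noncomputable def pMbar (M : Set E) (v : E) : ℝ :=
  sInf {s : ℝ | ∃ (t : ℕ → ℝ) (m : ℕ → E) (w : E), (∀ j, 0 ≤ t j) ∧ (∀ j, m j ∈ M) ∧
        Summable t ∧ HasSum (fun j => t j • m j) w ∧ |v| ≤ w ∧ s = ∑' j, t j}

end MbarDefs

section Helpers

variable {E : Type*} [NormedAddCommGroup E] [NormedSpace ℝ E] {M : Set E}

/-- `w` is the sum of a series `∑ t_j • m_j` with `m_j ∈ M`, `t_j ≥ 0` and `∑ t_j = s`. -/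
def MbarRep (M : Set E) (s : ℝ) (w : E) : Prop :=
  ∃ (t : ℕ → ℝ) (m : ℕ → E), (∀ j, 0 ≤ t j) ∧ (∀ j, m j ∈ M) ∧
    HasSum t s ∧ HasSum (fun j => t j • m j) w

theorem MbarRep.zero (hM : M.Nonempty) : MbarRep M 0 0 := by
  obtain ⟨m, hm⟩ := hM
  exact ⟨fun _ => 0, fun _ => m, fun _ => le_rfl, fun _ => hm, hasSum_zero, by simp⟩

theorem MbarRep.nonneg {s : ℝ} {w : E} (h : MbarRep M s w) : 0 ≤ s := by
  obtain ⟨t, m, ht, -, hs, -⟩ := h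
  exact hs.nonneg ht

theorem MbarRep.smul {s c : ℝ} {w : E} (hc : 0 ≤ c) (h : MbarRep M s w) :
    MbarRep M (c * s) (c • w) := by
  obtain ⟨t, m, ht, hm, hs, hw⟩ := h
  refine ⟨fun j => c * t j, m, fun j => mul_nonneg hc (ht j), hm, hs.mul_left c, ?_⟩
  simpa only [mul_smul] using hw.const_smul c

theorem norm_smul_le_of_bounded {C : ℝ} (hC : ∀ m ∈ M, ‖m‖ ≤ C) {t : ℝ} {m : E} (ht : 0 ≤ t)
    (hm : m ∈ M) : ‖t • m‖ ≤ t * C := by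
  rw [norm_smul, Real.norm_of_nonneg ht]
  exact mul_le_mul_of_nonneg_left (hC m hm) ht

theorem MbarRep.norm_le {C : ℝ} (hC : ∀ m ∈ M, ‖m‖ ≤ C) {s : ℝ} {w : E} (h : MbarRep M s w) :
    ‖w‖ ≤ s * C := by
  obtain ⟨t, m, ht, hm, hs, hw⟩ := h
  rw [← hw.tsum_eq]
  exact tsum_of_norm_bounded (hs.mul_right C) fun j => norm_smul_le_of_bounded hC (ht j) (hm j)

theorem MbarRep.summable [CompleteSpace E] {C : ℝ} (hC : ∀ m ∈ M, ‖m‖ ≤ C) {s : ℕ → ℝ}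
    {w : ℕ → E} (h : ∀ k, MbarRep M (s k) (w k)) (hs : Summable s) : Summable w :=
  .of_norm_bounded (hs.mul_right C) fun k => (h k).norm_le hC

/-- Representations with summable total masses can be added up over a sequence. -/
theorem MbarRep.tsum [CompleteSpace E] {C : ℝ} (hC : ∀ m ∈ M, ‖m‖ ≤ C) {s : ℕ → ℝ}
    {w : ℕ → E} (h : ∀ k, MbarRep M (s k) (w k)) (hs : Summable s) :
    MbarRep M (∑' k, s k) (∑' k, w k) := by
  choose t m ht hm hts hw using h
  have htsum : Summable fun q : ℕ × ℕ => t q.1 q.2 := by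
    refine (summable_prod_of_nonneg fun q => ht q.1 q.2).2 ⟨fun k => (hts k).summable, ?_⟩
    simpa only [fun k => (hts k).tsum_eq] using hs
  have hmsum : Summable fun q : ℕ × ℕ => t q.1 q.2 • m q.1 q.2 :=
    .of_norm_bounded (htsum.mul_right C) fun q =>
      norm_smul_le_of_bounded hC (ht q.1 q.2) (hm q.1 q.2)
  refine ⟨fun j => t j.unpair.1 j.unpair.2, fun j => m j.unpair.1 j.unpair.2,
    fun j => ht _ _, fun j => hm _ _, ?_, ?_⟩
  · rw [(htsum.hasSum.prod_fiberwise hts).tsum_eq]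
    exact (Nat.pairEquiv.symm.hasSum_iff (f := fun q : ℕ × ℕ => t q.1 q.2)).2 htsum.hasSum
  · rw [(hmsum.hasSum.prod_fiberwise hw).tsum_eq]
    exact (Nat.pairEquiv.symm.hasSum_iff
      (f := fun q : ℕ × ℕ => t q.1 q.2 • m q.1 q.2)).2 hmsum.hasSum

variable [Lattice E]

/-- `|v|` is majorized by a series over `M` of total mass `s`. -/
def MbarDominated (M : Set E) (s : ℝ) (v : E) : Prop :=
  ∃ w, MbarRep M s w ∧ |v| ≤ w

theorem MbarDominated.nonneg {s : ℝ} {v : E} (h : MbarDominated M s v) : 0 ≤ s := by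
  obtain ⟨w, hw, -⟩ := h
  exact hw.nonneg

theorem MbarDominated.mono {s : ℝ} {v u : E} (h : MbarDominated M s v) (huv : |u| ≤ |v|) :
    MbarDominated M s u := by
  obtain ⟨w, hw, hvw⟩ := h
  exact ⟨w, hw, huv.trans hvw⟩

theorem MbarDominated.zero [IsOrderedAddMonoid E] (hM : M.Nonempty) :
    MbarDominated M 0 (0 : E) :=
  ⟨0, .zero hM, by simp⟩

theorem abs_smul_le_abs_smul_abs [IsOrderedAddMonoid E] [PosSMulMono ℝ E] (c : ℝ) (v : E) :
    |c • v| ≤ |c| • |v| := by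
  have key : ∀ (a : ℝ) (u : E), 0 ≤ a → |a • u| ≤ a • |u| := fun a u ha =>
    abs_le'.2 ⟨smul_le_smul_of_nonneg_left (le_abs_self u) ha, by
      rw [← smul_neg]; exact smul_le_smul_of_nonneg_left (neg_le_abs u) ha⟩
  rcases le_total 0 c with hc | hc
  · simpa only [abs_of_nonneg hc] using key c v hc
  · simpa only [abs_of_nonpos hc, neg_smul_neg, abs_neg] using key (-c) (-v) (neg_nonneg.2 hc)

theorem MbarDominated.smul [IsOrderedAddMonoid E] [PosSMulMono ℝ E] {s : ℝ} {v : E} (c : ℝ)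
    (h : MbarDominated M s v) : MbarDominated M (|c| * s) (c • v) := by
  obtain ⟨w, hw, hvw⟩ := h
  exact ⟨|c| • w, hw.smul (abs_nonneg c), (abs_smul_le_abs_smul_abs c v).trans
    (smul_le_smul_of_nonneg_left hvw (abs_nonneg c))⟩

theorem mem_EMbar_iff {v : E} : v ∈ EMbar M ↔ ∃ s, MbarDominated M s v := by
  constructor
  · rintro ⟨w, ⟨t, m, ht, hm, hs, hw⟩, hvw⟩
    exact ⟨∑' j, t j, w, ⟨t, m, ht, hm, hs.hasSum, hw⟩, hvw⟩
  · rintro ⟨s, w, ⟨t, m, ht, hm, hs, hw⟩, hvw⟩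
    exact ⟨w, ⟨t, m, ht, hm, hs.summable, hw⟩, hvw⟩

theorem pMbar_eq_sInf (v : E) : pMbar M v = sInf {s | MbarDominated M s v} := by
  unfold pMbar
  congr 1
  ext s
  constructor
  · rintro ⟨t, m, w, ht, hm, hs, hw, hvw, rfl⟩
    exact ⟨w, ⟨t, m, ht, hm, hs.hasSum, hw⟩, hvw⟩
  · rintro ⟨w, ⟨t, m, ht, hm, hs, hw⟩, hvw⟩
    exact ⟨t, m, w, ht, hm, hs.summable, hw, hvw, hs.tsum_eq.symm⟩

theorem pMbar_nonneg (v : E) : 0 ≤ pMbar M v := by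
  rw [pMbar_eq_sInf]
  exact Real.sInf_nonneg fun _ hs => MbarDominated.nonneg hs

theorem MbarDominated.pMbar_le {s : ℝ} {v : E} (h : MbarDominated M s v) : pMbar M v ≤ s := by
  rw [pMbar_eq_sInf]
  exact csInf_le ⟨0, fun _ hs => MbarDominated.nonneg hs⟩ h

theorem exists_dominated_lt_of_mem {v : E} (hv : v ∈ EMbar M) {ε : ℝ} (hε : 0 < ε) :
    ∃ s, MbarDominated M s v ∧ s < pMbar M v + ε := by
  rw [pMbar_eq_sInf]
  exact Real.lt_sInf_add_pos (mem_EMbar_iff.1 hv) hε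

theorem smul_mem_EMbar [IsOrderedAddMonoid E] [PosSMulMono ℝ E] (c : ℝ) {v : E} (hv : v ∈ EMbar M) :
    c • v ∈ EMbar M := by
  obtain ⟨s, hs⟩ := mem_EMbar_iff.1 hv
  exact mem_EMbar_iff.2 ⟨_, hs.smul c⟩

theorem pMbar_smul_le [IsOrderedAddMonoid E] [PosSMulMono ℝ E] (c : ℝ) {v : E} (hv : v ∈ EMbar M) :
    pMbar M (c • v) ≤ |c| * pMbar M v := by
  rw [pMbar_eq_sInf v, ← smul_eq_mul, ← Real.sInf_smul_of_nonneg (abs_nonneg c)]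
  refine le_csInf (Set.Nonempty.smul_set (mem_EMbar_iff.1 hv)) ?_
  rintro _ ⟨s, hs, rfl⟩
  exact (MbarDominated.smul c hs).pMbar_le

theorem pMbar_smul [IsOrderedAddMonoid E] [PosSMulMono ℝ E] (hM : M.Nonempty) (c : ℝ) {v : E}
    (hv : v ∈ EMbar M) :
    pMbar M (c • v) = |c| * pMbar M v := by
  rcases eq_or_ne c 0 with rfl | hc
  · simpa using le_antisymm (MbarDominated.zero hM).pMbar_le (pMbar_nonneg (M := M) (0 : E))
  · refine le_antisymm (pMbar_smul_le c hv) ?_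
    have h := pMbar_smul_le c⁻¹ (smul_mem_EMbar c hv)
    rwa [inv_smul_smul₀ hc, abs_inv, ← div_eq_inv_mul, le_div_iff₀' (abs_pos.2 hc)] at h

variable [HasSolidNorm E] [IsOrderedAddMonoid E]

theorem MbarDominated.norm_le {C : ℝ} (hC : ∀ m ∈ M, ‖m‖ ≤ C) {s : ℝ}
    {v : E} (h : MbarDominated M s v) : ‖v‖ ≤ s * C := by
  obtain ⟨w, hw, hvw⟩ := h
  exact (norm_le_norm_of_abs_le_abs (hvw.trans (le_abs_self w))).trans (hw.norm_le hC)

theorem MbarDominated.summable [CompleteSpace E] {C : ℝ} (hC : ∀ m ∈ M, ‖m‖ ≤ C) {s : ℕ → ℝ}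
    {x : ℕ → E} (h : ∀ k, MbarDominated M (s k) (x k)) (hs : Summable s) : Summable x :=
  .of_norm_bounded (hs.mul_right C) fun k => (h k).norm_le hC

theorem MbarDominated.tsum [CompleteSpace E] {C : ℝ} (hC : ∀ m ∈ M, ‖m‖ ≤ C) {s : ℕ → ℝ}
    {x : ℕ → E} (h : ∀ k, MbarDominated M (s k) (x k)) (hs : Summable s) :
    MbarDominated M (∑' k, s k) (∑' k, x k) := by
  have hx := MbarDominated.summable hC h hs
  choose w hw hxw using h
  have hwsum := MbarRep.summable hC hw hs
  refine ⟨∑' k, w k, MbarRep.tsum hC hw hs, abs_le'.2 ⟨?_, ?_⟩⟩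
  · exact hx.tsum_le_tsum (fun k => (le_abs_self _).trans (hxw k)) hwsum
  · rw [← tsum_neg]
    exact hx.neg.tsum_le_tsum (fun k => (neg_le_abs _).trans (hxw k)) hwsum

theorem MbarDominated.add [CompleteSpace E] (hM : M.Nonempty) {C : ℝ}
    (hC : ∀ m ∈ M, ‖m‖ ≤ C) {a b : ℝ} {u v : E} (hu : MbarDominated M a u)
    (hv : MbarDominated M b v) : MbarDominated M (a + b) (u + v) := by
  let s : ℕ → ℝ := fun | 0 => a | 1 => b | _ => 0
  let x : ℕ → E := fun | 0 => u | 1 => v | _ => 0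
  have hs : HasSum s (∑ k ∈ Finset.range 2, s k) := hasSum_sum_of_ne_finset_zero fun k hk => by
    match k, hk with
    | 0, hk => simp at hk
    | 1, hk => simp at hk
    | _ + 2, _ => rfl
  have hx : HasSum x (∑ k ∈ Finset.range 2, x k) := hasSum_sum_of_ne_finset_zero fun k hk => by
    match k, hk with
    | 0, hk => simp at hk
    | 1, hk => simp at hk
    | _ + 2, _ => rfl
  have h : ∀ k, MbarDominated M (s k) (x k) := fun
    | 0 => hu
    | 1 => hv
    | _ + 2 => .zero hM
  have := MbarDominated.tsum hC h hs.summable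
  rwa [hs.tsum_eq, hx.tsum_eq, Finset.sum_range_succ, Finset.sum_range_one,
    Finset.sum_range_succ, Finset.sum_range_one] at this

theorem norm_le_pMbar_mul {C : ℝ} (hC : ∀ m ∈ M, ‖m‖ ≤ C) {v : E} (hC0 : 0 ≤ C)
    (hv : v ∈ EMbar M) : ‖v‖ ≤ pMbar M v * C := by
  refine le_of_forall_pos_le_add fun ε hε => ?_
  obtain ⟨s, hs, hlt⟩ := exists_dominated_lt_of_mem hv (div_pos hε (by positivity : 0 < C + 1))
  have h1 : ε / (C + 1) * C ≤ ε := by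
    rw [div_mul_eq_mul_div, div_le_iff₀ (by positivity)]
    nlinarith
  have h2 := mul_le_mul_of_nonneg_right hlt.le hC0
  linarith [hs.norm_le hC]

theorem pMbar_add_le [CompleteSpace E] (hM : M.Nonempty) {C : ℝ} (hC : ∀ m ∈ M, ‖m‖ ≤ C)
    {v w : E} (hv : v ∈ EMbar M) (hw : w ∈ EMbar M) :
    pMbar M (v + w) ≤ pMbar M v + pMbar M w := by
  refine le_of_forall_pos_le_add fun ε hε => ?_
  obtain ⟨a, ha, hav⟩ := exists_dominated_lt_of_mem hv (half_pos hε)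
  obtain ⟨b, hb, hbw⟩ := exists_dominated_lt_of_mem hw (half_pos hε)
  linarith [(ha.add hM hC hb).pMbar_le]

theorem exists_tendsto_pMbar_of_summable [CompleteSpace E] {C : ℝ} (hC : ∀ m ∈ M, ‖m‖ ≤ C)
    {x : ℕ → E} (hx : ∀ k, x k ∈ EMbar M) (hsum : Summable fun k => pMbar M (x k)) :
    ∃ l ∈ EMbar M, Filter.Tendsto
      (fun n => pMbar M ((∑ k ∈ Finset.range n, x k) - l)) Filter.atTop (nhds 0) := by
  choose s hs hlt using fun k =>
    exists_dominated_lt_of_mem (hx k) (pow_pos (by norm_num : (0 : ℝ) < 1 / 2) k)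
  have hssum : Summable s := .of_nonneg_of_le (fun k => (hs k).nonneg) (fun k => (hlt k).le)
    (hsum.add summable_geometric_two)
  have hxsum := MbarDominated.summable hC hs hssum
  refine ⟨∑' k, x k, mem_EMbar_iff.2 ⟨_, .tsum hC hs hssum⟩,
    squeeze_zero (fun n => pMbar_nonneg _) (fun n => ?_) (tendsto_sum_nat_add s)⟩
  have htail : MbarDominated M (∑' k, s (k + n)) (∑' k, x (k + n)) :=
    .tsum hC (fun k => hs (k + n)) ((summable_nat_add_iff n).2 hssum)
  refine (htail.mono ?_).pMbar_le
  rw [← hxsum.sum_add_tsum_nat_add n, sub_add_cancel_left, abs_neg]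

end Helpers

/-- Let `E` be a Banach lattice and `M` a positive uniformly bounded subset.
Then `(E_{M̅}, p_{M̅})` is a Banach lattice: `E_{M̅}` is an ideal of `E`, `p_{M̅}` is a lattice
norm on it, and every absolutely `p_{M̅}`-summable series converges in the `p_{M̅}`-norm. -/
theorem EMbar_is_Banach_lattice
    {E : Type*} [NormedAddCommGroup E] [Lattice E] [HasSolidNorm E] [IsOrderedAddMonoid E]
    [NormedSpace ℝ E] [IsStrictOrderedModule ℝ E]
    [CompleteSpace E]
    (M : Set E) (hMne : M.Nonempty) (hMpos : ∀ m ∈ M, 0 ≤ m)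
    (hMhull : (0 : E) ∉ convexHull ℝ M)
    (hbdd : ∃ C : ℝ, ∀ m ∈ M, ‖m‖ ≤ C) :
    ((0 : E) ∈ EMbar M) ∧
    (∀ v ∈ EMbar M, ∀ w ∈ EMbar M, v + w ∈ EMbar M) ∧
    (∀ (c : ℝ), ∀ v ∈ EMbar M, c • v ∈ EMbar M) ∧
    (∀ v : E, ∀ w ∈ EMbar M, |v| ≤ |w| → v ∈ EMbar M) ∧
    (∀ v ∈ EMbar M, pMbar M v = 0 → v = 0) ∧
    (∀ v ∈ EMbar M, ∀ w ∈ EMbar M, pMbar M (v + w) ≤ pMbar M v + pMbar M w) ∧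
    (∀ (c : ℝ), ∀ v ∈ EMbar M, pMbar M (c • v) = |c| * pMbar M v) ∧
    (∀ v ∈ EMbar M, ∀ w ∈ EMbar M, |v| ≤ |w| → pMbar M v ≤ pMbar M w) ∧
    (∀ x : ℕ → E, (∀ k, x k ∈ EMbar M) → Summable (fun k => pMbar M (x k)) →
      ∃ l ∈ EMbar M, Filter.Tendsto
        (fun n => pMbar M ((∑ k ∈ Finset.range n, x k) - l)) Filter.atTop (nhds 0)) := by
  obtain ⟨C, hC⟩ := hbdd
  have hC0 : 0 ≤ C := by
    obtain ⟨m, hm⟩ := hMne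
    exact (norm_nonneg m).trans (hC m hm)
  refine ⟨mem_EMbar_iff.2 ⟨0, .zero hMne⟩, fun v hv w hw => ?_, fun c v hv => smul_mem_EMbar c hv,
    fun v w hw hvw => ?_, fun v hv h0 => ?_, fun v hv w hw => pMbar_add_le hMne hC hv hw,
    fun c v hv => pMbar_smul hMne c hv, fun v _ w hw hvw => ?_,
    fun x hx hsum => exists_tendsto_pMbar_of_summable hC hx hsum⟩
  · obtain ⟨a, ha⟩ := mem_EMbar_iff.1 hv
    obtain ⟨b, hb⟩ := mem_EMbar_iff.1 hw
    exact mem_EMbar_iff.2 ⟨_, ha.add hMne hC hb⟩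
  · obtain ⟨s, hs⟩ := mem_EMbar_iff.1 hw
    exact mem_EMbar_iff.2 ⟨s, hs.mono hvw⟩
  · have h := norm_le_pMbar_mul hC hC0 hv
    rw [h0, zero_mul] at h
    exact norm_le_zero_iff.1 h
  · rw [pMbar_eq_sInf w]
    exact le_csInf (mem_EMbar_iff.1 hw) fun s hs => (MbarDominated.mono hs hvw).pMbar_le
end

section
/- Let $E$ be a Banach lattice and let $V \subseteq E$ be an ideal. Then $V$ is not dense in $E$ if and only if there exists a non-zero positive linear functional on $E$ which vanishes on $V$. -/
open scoped BigOperators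

section

variable {E : Type*} [NormedAddCommGroup E] [Lattice E] [HasSolidNorm E] [IsOrderedAddMonoid E]
  [NormedSpace ℝ E]

/-- In a normed lattice which is a real vector space, compatibility of the order with nonnegative
real scalars is automatic. -/
lemma real_smul_nonneg_of_solid {t : ℝ} (ht : 0 ≤ t) {x : E} (hx : 0 ≤ x) : 0 ≤ t • x := by
  have half : ∀ (n : ℕ) (y : E), 0 ≤ y → 0 ≤ ((2 : ℝ) ^ n)⁻¹ • y := by
    intro n
    induction n with
    | zero => intro y hy; simpa using hy
    | succ n ih =>
      intro y hy
      refine nsmul_two_semiclosed ?_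
      convert ih y hy using 1
      rw [← Nat.cast_smul_eq_nsmul ℝ, smul_smul]
      congr 1
      field_simp
      norm_num [pow_succ, mul_comm]
  have hlim : Filter.Tendsto (fun n : ℕ => ((⌊t * (2 : ℝ) ^ n⌋₊ : ℝ) / (2 : ℝ) ^ n) • x)
      Filter.atTop (nhds (t • x)) :=
    ((tendsto_nat_floor_mul_div_atTop ht).comp
      (tendsto_pow_atTop_atTop_of_one_lt one_lt_two)).smul_const x
  refine ge_of_tendsto' hlim fun n => ?_
  rw [div_eq_inv_mul, mul_smul, Nat.cast_smul_eq_nsmul]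
  exact half n _ (nsmul_nonneg hx _)

/-- A positive linear functional on a Banach lattice is norm-bounded. -/
lemma LinearMap.exists_bound_of_nonneg [CompleteSpace E] (ψ : E →ₗ[ℝ] ℝ)
    (hψ : ∀ v : E, 0 ≤ v → 0 ≤ ψ v) : ∃ C : ℝ, ∀ x, ‖ψ x‖ ≤ C * ‖x‖ := by
  have mono : ∀ a b : E, a ≤ b → ψ a ≤ ψ b := fun a b h => by
    simpa using hψ (b - a) (sub_nonneg.2 h)
  by_contra! h
  choose y hy using fun n : ℕ => h ((2 : ℝ) ^ n)
  have hy0 : ∀ n, 0 < ‖ψ (y n)‖ := fun n => lt_of_le_of_lt (by positivity) (hy n)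
  set x : ℕ → E := fun n => ‖ψ (y n)‖⁻¹ • |y n| with hx
  have xnn : ∀ n, 0 ≤ x n := fun n => real_smul_nonneg_of_solid (by positivity) (abs_nonneg _)
  have xnorm : ∀ n, ‖x n‖ ≤ (1 / 2 : ℝ) ^ n := fun n => by
    rw [hx]
    simp only [norm_smul, norm_inv, norm_norm, norm_abs_eq_norm]
    rw [inv_mul_le_iff₀ (hy0 n), one_div, inv_pow, ← div_eq_mul_inv, le_div_iff₀ (by positivity),
      mul_comm]
    exact (hy n).le
  have ψx : ∀ n, 1 ≤ ψ (x n) := fun n => by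
    rw [hx]
    simp only [map_smul, smul_eq_mul]
    rw [le_inv_mul_iff₀ (hy0 n), mul_one, Real.norm_eq_abs]
    refine abs_le'.2 ⟨mono _ _ (le_abs_self _), ?_⟩
    rw [← map_neg]
    exact mono _ _ (neg_le_abs _)
  have hs : Summable x := Summable.of_norm_bounded summable_geometric_two xnorm
  have key : ∀ N : ℕ, (N : ℝ) ≤ ψ (∑' n, x n) := fun N =>
    calc (N : ℝ) = ∑ n ∈ Finset.range N, (1 : ℝ) := by simp
      _ ≤ ∑ n ∈ Finset.range N, ψ (x n) := Finset.sum_le_sum fun n _ => ψx n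
      _ = ψ (∑ n ∈ Finset.range N, x n) := (map_sum ψ _ _).symm
      _ ≤ ψ (∑' n, x n) := mono _ _ (hs.sum_le_tsum _ fun n _ => xnn n)
  obtain ⟨N, hN⟩ := exists_nat_gt (ψ (∑' n, x n))
  exact (key N).not_gt hN

end

/-- If `|x| ≤ |v| + e`, then truncating `x` at `±|v|` changes it by at most `e`. -/
lemma exists_abs_le_abs_sub_le {E : Type*} [AddCommGroup E] [Lattice E] [IsOrderedAddMonoid E]
    {x v e : E} (he : 0 ≤ e) (h : |x| ≤ |v| + e) :
    ∃ w : E, |w| ≤ |v| ∧ |x - w| ≤ e := by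
  have hvv : -|v| ≤ |v| := (neg_nonpos.2 (abs_nonneg v)).trans (abs_nonneg v)
  refine ⟨(x ⊓ |v|) ⊔ (-|v|), abs_le'.2 ⟨sup_le inf_le_right hvv, neg_le.2 le_sup_right⟩,
    abs_le'.2 ⟨?_, ?_⟩⟩
  · rw [sub_le_comm]
    refine le_trans (le_inf (sub_le_self x he) ?_) le_sup_left
    exact sub_le_iff_le_add.2 ((le_abs_self x).trans h)
  · rw [neg_sub, sub_le_iff_le_add]
    refine sup_le (inf_le_left.trans (le_add_of_nonneg_left he)) ?_
    have h1 : -x ≤ |v| + e := (neg_le_abs x).trans h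
    rw [neg_le_iff_add_nonneg] at h1 ⊢
    convert h1 using 1
    abel

/-- Let `E` be a Banach lattice and `V ⊆ E` an ideal. Then `V` is not dense
in `E` if and only if there is a non-zero positive linear functional on `E` vanishing on `V`. -/
theorem nondensity_of_ideals
    {E : Type*} [NormedAddCommGroup E] [Lattice E] [HasSolidNorm E] [IsOrderedAddMonoid E] [NormedSpace ℝ E] [CompleteSpace E]
    (V : Submodule ℝ E) (hV : ∀ v w : E, w ∈ V → |v| ≤ |w| → v ∈ V) :
    ¬ Dense (V : Set E) ↔
      ∃ ψ : E →ₗ[ℝ] ℝ, ψ ≠ 0 ∧ (∀ v : E, 0 ≤ v → 0 ≤ ψ v) ∧ ∀ v ∈ V, ψ v = 0 := by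
  constructor
  · intro hd
    obtain ⟨x, hx⟩ := not_forall.1 hd
    rw [Metric.mem_closure_iff] at hx
    push Not at hx
    obtain ⟨ε, hε, hx⟩ := hx
    let S : Set E := {y | ∃ v ∈ V, 0 ≤ y + v}
    have hS : ∀ y ∈ S, ∀ t : ℝ, 0 ≤ t → t • y ∈ S := by
      rintro y ⟨v, hv, hy⟩ t ht
      exact ⟨t • v, V.smul_mem t hv, by
        rw [← smul_add]; exact real_smul_nonneg_of_solid ht hy⟩
    have hSconv : Convex ℝ S := by
      intro y hy z hz a b ha hb _
      obtain ⟨v, hv, hyv⟩ := hS y hy a ha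
      obtain ⟨w, hw, hzw⟩ := hS z hz b hb
      exact ⟨v + w, V.add_mem hv hw, by
        rw [add_add_add_comm]; exact add_nonneg hyv hzw⟩
    have hdisj : Disjoint (Metric.ball (-|x|) ε) S := by
      rw [Set.disjoint_left]
      rintro y hy ⟨v, hv, hyv⟩
      have hbound : |x| ≤ |v| + |y + abs x| := by
        calc |x| ≤ |x| + (y + v) := le_add_of_nonneg_right hyv
          _ = v + (y + |x|) := by abel
          _ ≤ |v| + |y + abs x| := add_le_add (le_abs_self _) (le_abs_self _)
      obtain ⟨w, hwv, hxw⟩ := exists_abs_le_abs_sub_le (abs_nonneg _) hbound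
      have hle : ‖x - w‖ ≤ ‖y + |x|‖ := HasSolidNorm.solid hxw
      rw [Metric.mem_ball, dist_eq_norm, sub_neg_eq_add] at hy
      have := hx w (hV w v hv hwv)
      rw [dist_eq_norm] at this
      exact (hle.trans_lt hy).not_ge this
    obtain ⟨f, u, hfu, huf⟩ :=
      geometric_hahn_banach_open (convex_ball _ _) Metric.isOpen_ball hSconv hdisj
    have hu : u ≤ 0 := by simpa using huf 0 ⟨0, V.zero_mem, by simp⟩
    have hfS : ∀ y ∈ S, 0 ≤ f y := by
      intro y hy
      by_contra! hneg
      obtain ⟨n, hn⟩ := exists_nat_gt (u / f y)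
      have h1 := huf _ (hS y hy n n.cast_nonneg)
      rw [map_smul, smul_eq_mul] at h1
      rw [div_lt_iff_of_neg hneg] at hn
      exact h1.not_gt hn
    have hVS : ∀ v ∈ V, v ∈ S := fun v hv => ⟨-v, V.neg_mem hv, by simp⟩
    refine ⟨f.toLinearMap, ?_, fun v hv => hfS v ⟨0, V.zero_mem, by simpa using hv⟩, ?_⟩
    · intro h0
      have h1 := hfu (-|x|) (Metric.mem_ball_self hε)
      have h2 : f (-|x|) = 0 := LinearMap.congr_fun h0 (-|x|)
      linarith
    · intro v hv
      have h1 := hfS v (hVS v hv)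
      have h2 := hfS (-v) (hVS _ (V.neg_mem hv))
      rw [map_neg] at h2
      change f v = 0
      linarith
  · rintro ⟨ψ, hne, hpos, hvan⟩ hd
    obtain ⟨C, hC⟩ := ψ.exists_bound_of_nonneg hpos
    have hcont : Continuous ψ := (ψ.mkContinuous C hC).continuous
    refine hne (LinearMap.ext fun x => ?_)
    exact congr_fun (hcont.ext_on hd continuous_const (g := fun _ => (0 : ℝ)) hvan) x
end

section
/- Let $E$ be a Banach lattice and $M$ a positive uniformly bounded subset of $E$. Then $E_M$ is dense in $E_{\overline{M}}$ with respect to the $p_{\overline{M}}$-norm. -/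
open scoped BigOperators

/-- A finite nonnegative combination of elements of a positive subset `M` lies in `coneGen M`. -/
theorem sum_smul_mem_coneGen {E ι : Type*} [AddCommGroup E] [PartialOrder E] [Module ℝ E]
    {M : Set E} (hM : IsPositiveSubset M) (s : Finset ι) {t : ι → ℝ} {m : ι → E}
    (ht : ∀ j ∈ s, 0 ≤ t j) (hm : ∀ j ∈ s, m j ∈ M) :
    ∑ j ∈ s, t j • m j ∈ coneGen M := by
  have hne : ∀ x ∈ convexHull ℝ M, x ≠ 0 := fun x hx h => hM.2.2 (h ▸ hx)
  rcases (Finset.sum_nonneg ht).eq_or_lt with h | h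
  · obtain ⟨m₀, hm₀⟩ := hM.1
    have hm₀' := subset_convexHull ℝ M hm₀
    refine ⟨0, m₀, le_rfl, hm₀', hne _ hm₀', ?_⟩
    have hz := (Finset.sum_eq_zero_iff_of_nonneg ht).mp h.symm
    rw [zero_smul]
    exact Finset.sum_eq_zero fun j hj => by rw [hz j hj, zero_smul]
  · have hc := s.centerMass_mem_convexHull ht h hm
    refine ⟨_, _, h.le, hc, hne _ hc, ?_⟩
    rw [Finset.centerMass, smul_inv_smul₀ h.ne']

/-- If `|v| ≤ a + b` with `a` and `b` nonnegative, truncating `v` to the order interval `[-a, a]`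
changes it by at most `b`. -/
theorem exists_between_neg_abs_sub_le {E : Type*} [AddCommGroup E] [Lattice E]
    [IsOrderedAddMonoid E] {v a b : E} (ha : 0 ≤ a) (hb : 0 ≤ b) (h : |v| ≤ a + b) :
    ∃ u, -u ≤ a ∧ u ≤ a ∧ |v - u| ≤ b := by
  refine ⟨(v ⊓ a) ⊔ -a, neg_le.mp le_sup_right,
    sup_le inf_le_right ((neg_nonpos.mpr ha).trans ha), ?_⟩
  rw [abs_le']
  constructor
  · rw [sub_le_comm]
    exact le_sup_of_le_left
      (le_inf (sub_le_self v hb) (sub_le_iff_le_add.mpr ((le_abs_self v).trans h)))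
  · rw [neg_sub, sub_le_iff_le_add']
    refine sup_le (inf_le_left.trans (le_add_of_nonneg_right hb)) ?_
    rw [neg_le_iff_add_nonneg, add_assoc, add_comm b a]
    exact neg_le_iff_add_nonneg'.mp ((neg_le_abs v).trans h)

/-- Let `E` be a Banach lattice and `M` a positive uniformly bounded subset.
Then `E_M` is dense in `E_{M̅}` with respect to the `p_{M̅}`-norm. -/
theorem EMaj_dense_in_EMbar
    {E : Type*} [NormedAddCommGroup E] [Lattice E] [HasSolidNorm E] [IsOrderedAddMonoid E]
    [NormedSpace ℝ E] [IsStrictOrderedModule ℝ E]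
    [CompleteSpace E]
    (M : Set E) (hM : IsPositiveSubset M)
    (hbdd : ∃ C : ℝ, ∀ m ∈ M, ‖m‖ ≤ C) :
    ∀ v ∈ EMbar M, ∀ ε : ℝ, 0 < ε → ∃ w ∈ EMaj M, pMbar M (v - w) < ε := by
  rintro v ⟨w, ⟨t, m, ht, hm, hts, hw⟩, hvw⟩ ε hε
  obtain ⟨n, hn⟩ := ((tendsto_sum_nat_add t).eventually_lt_const hε).exists
  have htail : HasSum (fun j => t (j + n) • m (j + n))
      (w - ∑ j ∈ Finset.range n, t j • m j) :=
    (hasSum_nat_add_iff' n).mpr hw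
  set S := ∑ j ∈ Finset.range n, t j • m j
  have hS : 0 ≤ S := Finset.sum_nonneg fun j _ => smul_nonneg (ht j) (hM.2.1 _ (hm j))
  have hR : 0 ≤ w - S := htail.nonneg fun j => smul_nonneg (ht _) (hM.2.1 _ (hm _))
  obtain ⟨u, hu₁, hu₂, hu⟩ := exists_between_neg_abs_sub_le hS hR (by simpa using hvw)
  refine ⟨u, ⟨S, sum_smul_mem_coneGen hM _ (fun j _ => ht j) fun j _ => hm j, hu₁, hu₂⟩, ?_⟩
  refine (csInf_le ⟨0, ?_⟩ ?_).trans_lt hn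
  · rintro s ⟨t', -, -, ht', -, -, -, -, rfl⟩
    exact tsum_nonneg ht'
  · exact ⟨_, _, _, fun j => ht (j + n), fun j => hm (j + n),
      (summable_nat_add_iff n).mpr hts, htail, hu, rfl⟩
end

section
/- Let $E$ be an ordered vector space, $M$ a positive subset of $E$, and $\psi$ a positive linear functional on $E_M$ which is uniformly bounded on $M$, with $C = \sup\{\psi(m) : m \in M\}$. Then $|\psi(v)| \le C\, p_M(v)$ for every $v \in E_M$; in particular $\psi$ is continuous with respect to the seminorm $p_M$ with operator norm at most $C$. Moreover, if $E$ carries a monotone norm, $M$ is uniformly bounded, and $\psi$ is constant on $M$, then the operator norm of $\psi$ with respect to the norm $p_M$ equals $\psi(m)$ for any $m \in M$. -/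
open scoped BigOperators

section Majorization

variable {E : Type*} [AddCommGroup E] [Module ℝ E] {M : Set E}

theorem exists_sum_of_mem_coneGen {c : E} (hc : c ∈ coneGen M) :
    ∃ (n : ℕ) (t : Fin n → ℝ) (m : Fin n → E),
      0 < n ∧ (∀ j, 0 ≤ t j) ∧ (∀ j, m j ∈ M) ∧ c = ∑ j, t j • m j := by
  obtain ⟨s, x, hs, hx, -, rfl⟩ := hc
  obtain ⟨ι, _, w, z, hw, hw1, hz, rfl⟩ := mem_convexHull_iff_exists_fintype.1 hx
  have : Nonempty ι := by
    by_contra h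
    rw [not_nonempty_iff] at h
    simp at hw1
  let e := (Fintype.equivFin ι).symm
  refine ⟨Fintype.card ι, fun j => s * w (e j), fun j => z (e j), Fintype.card_pos,
    fun j => mul_nonneg hs (hw _), fun j => hz _, ?_⟩
  rw [Equiv.sum_comp e fun i => (s * w i) • z i, Finset.smul_sum]
  simp only [mul_smul]

variable [PartialOrder E]

theorem IsPositiveSubset.sum_mem_coneGen (hM : IsPositiveSubset M) {n : ℕ} {t : Fin n → ℝ}
    {m : Fin n → E} (ht : ∀ j, 0 ≤ t j) (hm : ∀ j, m j ∈ M) :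
    ∑ j, t j • m j ∈ coneGen M := by
  obtain ⟨⟨a, ha⟩, -, h0⟩ := hM
  rcases (Finset.sum_nonneg fun j _ => ht j).eq_or_lt with hs | hs
  · have hzero : ∀ j, t j = 0 := fun j =>
      (Finset.sum_eq_zero_iff_of_nonneg fun j _ => ht j).1 hs.symm j (Finset.mem_univ j)
    have haM := subset_convexHull ℝ M ha
    exact ⟨0, a, le_rfl, haM, fun h => h0 (h ▸ haM), by simp [hzero]⟩
  · have hmem := Finset.centerMass_mem_convexHull Finset.univ (fun j _ => ht j) hs
      (fun j _ => hm j)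
    refine ⟨∑ j, t j, _, hs.le, hmem, fun h => h0 (h ▸ hmem), ?_⟩
    rw [Finset.centerMass, smul_inv_smul₀ hs.ne']

variable [IsOrderedAddMonoid E]

theorem IsPositiveSubset.mem_EMaj (hM : IsPositiveSubset M) {m : E} (hm : m ∈ M) :
    m ∈ EMaj M :=
  have hmM := subset_convexHull ℝ M hm
  ⟨m, ⟨1, m, zero_le_one, hmM, fun h => hM.2.2 (h ▸ hmM), (one_smul ℝ m).symm⟩,
    neg_le_self (hM.2.1 m hm), le_rfl⟩

theorem IsPositiveSubset.pM_le_one (hM : IsPositiveSubset M) {m : E} (hm : m ∈ M) :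
    pM M m ≤ 1 := by
  refine csInf_le ⟨0, ?_⟩ ⟨1, fun _ => 1, fun _ => m, one_pos, fun _ => zero_le_one,
    fun _ => hm, by simpa using neg_le_self (hM.2.1 m hm), by simp, by simp⟩
  rintro s ⟨n, t, x, -, ht, -, -, -, rfl⟩
  exact Finset.sum_nonneg fun j _ => ht j

variable [IsStrictOrderedModule ℝ E]

theorem IsPositiveSubset.coneGen_nonneg (hM : IsPositiveSubset M) {c : E}
    (hc : c ∈ coneGen M) : 0 ≤ c := by
  obtain ⟨t, m, ht, hm, -, rfl⟩ := hc
  exact smul_nonneg ht (convexHull_min hM.2.1 (convex_Ici (0 : E)) hm)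

/-- A functional that is positive on `E_M` respects the inequality `v ≤ c` defining `E_M`. -/
theorem IsPositiveSubset.map_le_of_le (hM : IsPositiveSubset M) {ψ : E →ₗ[ℝ] ℝ}
    (hpos : ∀ v ∈ EMaj M, 0 ≤ v → 0 ≤ ψ v) {v c : E} (hc : c ∈ coneGen M) (hneg : -v ≤ c)
    (hle : v ≤ c) : ψ v ≤ ψ c := by
  have hc0 := hM.coneGen_nonneg hc
  obtain ⟨t, m, ht, hm, hm0, rfl⟩ := hc
  have hsub : t • m - v ∈ EMaj M := by
    refine ⟨(2 * t) • m, ⟨2 * t, m, by positivity, hm, hm0, rfl⟩, ?_, ?_⟩ <;>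
      rw [mul_smul, two_smul]
    · rw [neg_sub]
      exact (sub_nonpos.2 hle).trans (add_nonneg hc0 hc0)
    · rw [sub_eq_add_neg]
      gcongr
  have := hpos _ hsub (sub_nonneg.2 hle)
  rwa [map_sub, sub_nonneg] at this

theorem IsPositiveSubset.abs_le_mul_pM (hM : IsPositiveSubset M) {ψ : E →ₗ[ℝ] ℝ}
    (hpos : ∀ v ∈ EMaj M, 0 ≤ v → 0 ≤ ψ v) {C : ℝ} (hC : ∀ m ∈ M, ψ m ≤ C) {v : E}
    (hv : v ∈ EMaj M) : |ψ v| ≤ C * pM M v := by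
  obtain ⟨a, ha⟩ := hM.1
  have hC0 : 0 ≤ C := (hpos a (hM.mem_EMaj ha) (hM.2.1 a ha)).trans (hC a ha)
  obtain ⟨c, hc, hneg, hle⟩ := hv
  obtain ⟨n, t, m, hn, ht, hm, rfl⟩ := exists_sum_of_mem_coneGen hc
  rw [pM, ← smul_eq_mul, ← Real.sInf_smul_of_nonneg hC0]
  refine le_csInf (Set.Nonempty.smul_set ⟨_, n, t, m, hn, ht, hm, hneg, hle, rfl⟩) ?_
  rintro _ ⟨_, ⟨k, s, x, -, hs, hx, hneg, hle, rfl⟩, rfl⟩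
  have hsum := hM.sum_mem_coneGen hs hx
  calc |ψ v| ≤ ψ (∑ j, s j • x j) := by
        refine abs_le'.2 ⟨hM.map_le_of_le hpos hsum hneg hle, ?_⟩
        rw [← map_neg]
        exact hM.map_le_of_le hpos hsum (by rwa [neg_neg]) hneg
    _ = ∑ j, s j * ψ (x j) := by simp
    _ ≤ ∑ j, s j * C :=
        Finset.sum_le_sum fun j _ => mul_le_mul_of_nonneg_left (hC _ (hx j)) (hs j)
    _ = C * ∑ j, s j := by rw [← Finset.sum_mul, mul_comm]

end Majorization

/-- Let `E` be an ordered vector space, `M` a positive subset, and `ψ` a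
positive linear functional on `E_M` uniformly bounded on `M` with `C = sup {ψ m : m ∈ M}`.
Then `|ψ v| ≤ C * p_M v` on `E_M`, so `ψ` is `p_M`-continuous with operator norm at most `C`.
Moreover, if `E` carries a monotone norm `N`, `M` is `N`-uniformly bounded and `ψ` is constant
on `M`, then the operator norm of `ψ` with respect to `p_M` equals the constant value. -/
theorem positive_functional_pM_continuous
    {E : Type*} [AddCommGroup E] [PartialOrder E] [IsOrderedAddMonoid E] [Module ℝ E] [IsStrictOrderedModule ℝ E]
    (M : Set E) (hM : IsPositiveSubset M)
    (ψ : E →ₗ[ℝ] ℝ) (hpos : ∀ v ∈ EMaj M, 0 ≤ v → 0 ≤ ψ v)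
    (hbdd : BddAbove ((fun m => ψ m) '' M))
    (C : ℝ) (hC : C = sSup ((fun m => ψ m) '' M)) :
    (∀ v ∈ EMaj M, |ψ v| ≤ C * pM M v) ∧
    (∀ N : E → ℝ,
      (∀ x y : E, N (x + y) ≤ N x + N y) →
      (∀ (c : ℝ) (x : E), N (c • x) = |c| * N x) →
      (∀ x : E, N x = 0 → x = 0) →
      (∀ x y : E, 0 ≤ x → x ≤ y → N x ≤ N y) →
      BddAbove (N '' M) →
      ∀ c : ℝ, (∀ m ∈ M, ψ m = c) →
        sSup {r : ℝ | ∃ v ∈ EMaj M, pM M v ≤ 1 ∧ r = |ψ v|} = c) := by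
  have hbound : ∀ m ∈ M, ψ m ≤ C := fun m hm => hC ▸ le_csSup hbdd ⟨m, hm, rfl⟩
  refine ⟨fun v hv => hM.abs_le_mul_pM hpos hbound hv, ?_⟩
  intro N _ _ _ _ _ c hc
  obtain ⟨a, ha⟩ := hM.1
  have hc0 : 0 ≤ c := hc a ha ▸ hpos a (hM.mem_EMaj ha) (hM.2.1 a ha)
  refine IsGreatest.csSup_eq ⟨⟨a, hM.mem_EMaj ha, hM.pM_le_one ha, ?_⟩, ?_⟩
  · rw [hc a ha, abs_of_nonneg hc0]
  · rintro _ ⟨v, hv, hv1, rfl⟩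
    exact (hM.abs_le_mul_pM hpos (fun m hm => (hc m hm).le) hv).trans
      (mul_le_of_le_one_right hc0 hv1)
end

section
/- Let $E$ be an ordered vector space and $M$ a positive subset of $E$. Then $M$ is coherent if and only if there exists a positive linear functional $\psi$ on $E_M$ with $\psi(m) = 1$ for every $m \in M$. -/
open scoped BigOperators

section CoherentDef

variable {E : Type*} [AddCommGroup E] [PartialOrder E] [Module ℝ E]

/-- A positive subset `M` is *coherent* if every positive finite linear combination of elements
of `M` (with arbitrary real coefficients) has nonnegative coefficient sum. -/
def Coherent (M : Set E) : Prop :=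
  ∀ (n : ℕ) (t : Fin n → ℝ) (m : Fin n → E),
    (∀ j, m j ∈ M) → 0 ≤ ∑ j, t j • m j → 0 ≤ ∑ j, t j

end CoherentDef

section

variable {E : Type*} [AddCommGroup E] [Module ℝ E]

/-- If every vanishing linear combination of elements of `M` has vanishing coefficient sum, some
linear functional is constantly `1` on `M`. -/
theorem exists_linearMap_eq_one_on {M : Set E}
    (h : ∀ l : M →₀ ℝ, Finsupp.linearCombination ℝ ((↑) : M → E) l = 0 →
      Finsupp.linearCombination ℝ (fun _ : M => (1 : ℝ)) l = 0) :
    ∃ φ : E →ₗ[ℝ] ℝ, ∀ m ∈ M, φ m = 1 := by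
  have hmem : Finsupp.linearCombination ℝ (fun _ : M => (1 : ℝ)) ∈
      (Finsupp.linearCombination ℝ ((↑) : M → E)).dualMap.range := by
    rw [LinearMap.range_dualMap_eq_dualAnnihilator_ker, Submodule.mem_dualAnnihilator]
    exact fun l hl => h l hl
  obtain ⟨φ, hφ⟩ := hmem
  refine ⟨φ, fun m hm => ?_⟩
  simpa using LinearMap.congr_fun hφ (Finsupp.single ⟨m, hm⟩ 1)

variable [PartialOrder E]

theorem Coherent.nonneg_finsupp {M : Set E} (h : Coherent M) (l : M →₀ ℝ)
    (hl : 0 ≤ Finsupp.linearCombination ℝ ((↑) : M → E) l) :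
    0 ≤ Finsupp.linearCombination ℝ (fun _ : M => (1 : ℝ)) l := by
  rw [Finsupp.linearCombination_apply, Finsupp.sum, ← Finset.sum_coe_sort,
    ← l.support.equivFin.symm.sum_comp] at hl ⊢
  simpa using h _ (fun j => l (l.support.equivFin.symm j))
    (fun j => (l.support.equivFin.symm j : M)) (fun j => Subtype.coe_prop _) hl

variable [IsOrderedAddMonoid E] [PosSMulMono ℝ E]

/-- The subspace of vectors `v` with `±v` bounded above by an element of the subspace `S`. -/
def Submodule.majorized (S : Submodule ℝ E) : Submodule ℝ E where
  carrier := {v | ∃ w ∈ S, -v ≤ w ∧ v ≤ w}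
  zero_mem' := ⟨0, S.zero_mem, by simp⟩
  add_mem' := by
    rintro a b ⟨v, hv, hv₁, hv₂⟩ ⟨w, hw, hw₁, hw₂⟩
    refine ⟨v + w, S.add_mem hv hw, ?_, add_le_add hv₂ hw₂⟩
    rw [neg_add]
    exact add_le_add hv₁ hw₁
  smul_mem' := by
    rintro a v ⟨w, hw, h₁, h₂⟩
    refine ⟨|a| • w, S.smul_mem _ hw, ?_⟩
    have h₁' := smul_le_smul_of_nonneg_left h₁ (abs_nonneg a)
    have h₂' := smul_le_smul_of_nonneg_left h₂ (abs_nonneg a)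
    rcases abs_cases a with ⟨ha, -⟩ | ⟨ha, -⟩ <;> rw [ha] at h₁' h₂' ⊢ <;>
      simp only [smul_neg, neg_smul, neg_neg] at h₁' h₂' ⊢
    · exact ⟨h₁', h₂'⟩
    · exact ⟨h₂', h₁'⟩

theorem EMaj_subset_majorized_span (M : Set E) :
    EMaj M ⊆ (Submodule.span ℝ M).majorized := by
  rintro v ⟨_, ⟨t, m, -, hm, -, rfl⟩, h⟩
  exact ⟨_, Submodule.smul_mem _ t
    (convexHull_min Submodule.subset_span (Submodule.span ℝ M).convex hm), h⟩

/-- A functional positive on the subspace `S` can be modified off `S` so as to be positive on the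
subspace majorized by `S`. -/
theorem exists_extension_nonneg_majorized (S : Submodule ℝ E) (φ : E →ₗ[ℝ] ℝ)
    (hφ : ∀ x ∈ S, 0 ≤ x → 0 ≤ φ x) :
    ∃ ψ : E →ₗ[ℝ] ℝ, (∀ x ∈ S.majorized, 0 ≤ x → 0 ≤ ψ x) ∧
      ∀ x ∈ S, x ∈ S.majorized → ψ x = φ x := by
  let P : Submodule ℝ S.majorized := S.comap S.majorized.subtype
  obtain ⟨g, hg, hg₀⟩ := riesz_extension
    ((PointedCone.positive ℝ E).comap S.majorized.subtype)
    ⟨P, φ ∘ₗ S.majorized.subtype ∘ₗ P.subtype⟩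
    (fun x hx => hφ _ x.2 (by simpa using hx))
    (by
      rintro ⟨y, w, hw, h₁, h₂⟩
      have hwS : w ∈ S.majorized := by
        refine ⟨w, hw, ?_, le_rfl⟩
        have h2 : (0 : E) ≤ (2 : ℝ) • w := by
          rw [two_smul]
          simpa using add_le_add h₁ h₂
        have hw₀ : 0 ≤ w := by
          simpa using smul_nonneg (by norm_num : (0 : ℝ) ≤ 2⁻¹) h2
        exact (neg_nonpos.2 hw₀).trans hw₀
      refine ⟨⟨⟨w, hwS⟩, hw⟩, ?_⟩
      simpa [neg_le_iff_add_nonneg] using h₁)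
  obtain ⟨ψ, hψ⟩ := g.exists_extend
  have hψ' (x : E) (hx : x ∈ S.majorized) : ψ x = g ⟨x, hx⟩ := LinearMap.congr_fun hψ ⟨x, hx⟩
  refine ⟨ψ, fun x hx hx₀ => ?_, fun x hxS hx => ?_⟩
  · rw [hψ' x hx]
    exact hg₀ _ (by simpa using hx₀)
  · rw [hψ' x hx]
    exact hg ⟨⟨x, hx⟩, hxS⟩

theorem sum_smul_mem_EMaj {M : Set E} (hM : IsPositiveSubset M) {ι : Type*} [Fintype ι]
    (t : ι → ℝ) (m : ι → E) (hm : ∀ j, m j ∈ M) (ht : 0 < ∑ j, |t j|) :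
    ∑ j, t j • m j ∈ EMaj M := by
  have hc : Finset.univ.centerMass (fun j => |t j|) m ∈ convexHull ℝ M :=
    Finset.univ.centerMass_mem_convexHull (fun j _ => abs_nonneg _) ht (fun j _ => hm j)
  refine ⟨∑ j, |t j| • m j, ⟨_, _, ht.le, hc, fun h => hM.2.2 (h ▸ hc), ?_⟩, ?_, ?_⟩
  · rw [Finset.centerMass, smul_inv_smul₀ ht.ne']
  · rw [← Finset.sum_neg_distrib]
    refine Finset.sum_le_sum fun j _ => ?_
    rw [← neg_smul, ← sub_nonneg, ← sub_smul]
    exact smul_nonneg (by linarith [neg_abs_le (t j)]) (hM.2.1 _ (hm j))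
  · refine Finset.sum_le_sum fun j _ => ?_
    rw [← sub_nonneg, ← sub_smul]
    exact smul_nonneg (by linarith [le_abs_self (t j)]) (hM.2.1 _ (hm j))

end

/-- Let `E` be an ordered vector space and `M` a positive subset. Then `M`
is coherent if and only if there is a linear functional which is positive on `E_M` and equal
to `1` at every point of `M`. -/
theorem coherent_iff_positive_functional
    {E : Type*} [AddCommGroup E] [PartialOrder E] [IsOrderedAddMonoid E] [Module ℝ E]
    [PosSMulStrictMono ℝ E] [PosSMulReflectLT ℝ E]
    (M : Set E) (hM : IsPositiveSubset M) :
    Coherent M ↔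
      ∃ ψ : E →ₗ[ℝ] ℝ, (∀ v ∈ EMaj M, 0 ≤ v → 0 ≤ ψ v) ∧ ∀ m ∈ M, ψ m = 1 := by
  constructor
  · intro h
    obtain ⟨φ, hφ⟩ := exists_linearMap_eq_one_on (M := M) fun l hl =>
      le_antisymm (by simpa using h.nonneg_finsupp (-l) (by simp [hl]))
        (h.nonneg_finsupp l hl.ge)
    obtain ⟨ψ, hψ, hψφ⟩ := exists_extension_nonneg_majorized (Submodule.span ℝ M) φ (by
      intro x hx hx₀
      obtain ⟨l, rfl⟩ := (Finsupp.mem_span_iff_linearCombination ℝ M x).1 hx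
      have hl := h.nonneg_finsupp l hx₀
      rw [Finsupp.apply_linearCombination]
      convert hl using 3
      ext m
      exact hφ m m.2)
    refine ⟨ψ, fun v hv => hψ v (EMaj_subset_majorized_span M hv), fun m hm => ?_⟩
    have hmS : m ∈ Submodule.span ℝ M := Submodule.subset_span hm
    have hm₀ := hM.2.1 m hm
    rw [hψφ m hmS ⟨m, hmS, (neg_nonpos.2 hm₀).trans hm₀, le_rfl⟩, hφ m hm]
  · rintro ⟨ψ, hψ, hψM⟩ n t m hm h₀
    rcases (Finset.sum_nonneg fun j _ => abs_nonneg (t j)).eq_or_lt with ht | ht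
    · linarith [neg_abs_le (∑ j, t j), Finset.abs_sum_le_sum_abs t Finset.univ]
    · simpa [hψM _ (hm _)] using hψ _ (sum_smul_mem_EMaj hM t m hm ht) h₀
end

section
/- Let $E$ be an ordered vector space and $M$ a positive subset of $E$. Then $M$ is coherent if and only if $p_M\left(\sum_{j=1}^n t_j m_j\right) = \sum_{j=1}^n t_j$ for all $n \ge 1$, all $t_1,\dots,t_n \ge 0$ and all $m_1,\dots,m_n \in M$; in other words, $p_M$ is additive on the cone $C_M$. -/
open scoped BigOperators

/-- Let `E` be an ordered vector space and `M` a positive subset. Then `M`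
is coherent if and only if `p_M (∑ t_j • m_j) = ∑ t_j` for all nonnegative coefficients `t_j`
and all `m_j ∈ M`; in other words, `p_M` is additive on the cone `C_M`. -/
theorem coherent_iff_pM_additive
    {E : Type*} [AddCommGroup E] [PartialOrder E] [IsOrderedAddMonoid E] [Module ℝ E] [IsStrictOrderedModule ℝ E]
    (M : Set E) (hM : IsPositiveSubset M) :
    Coherent M ↔
      ∀ (n : ℕ) (t : Fin n → ℝ) (m : Fin n → E), 0 < n → (∀ j, 0 ≤ t j) →
        (∀ j, m j ∈ M) → pM M (∑ j, t j • m j) = ∑ j, t j := by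
  have sum_nonneg : ∀ (n : ℕ) (t : Fin n → ℝ) (m : Fin n → E), (∀ j, 0 ≤ t j) →
      (∀ j, m j ∈ M) → 0 ≤ ∑ j, t j • m j := fun n t m ht hm =>
    Finset.sum_nonneg fun j _ => smul_nonneg (ht j) (hM.2.1 _ (hm j))
  constructor
  · intro hC n t m hn ht hm
    have hv := sum_nonneg n t m ht hm
    refine IsLeast.csInf_eq
      ⟨⟨n, t, m, hn, ht, hm, (neg_nonpos.2 hv).trans hv, le_rfl, rfl⟩, ?_⟩
    rintro _ ⟨k, s, m', -, -, hm', -, hle, rfl⟩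
    have key := hC (k + n) (Fin.append s (-t)) (Fin.append m' m)
      (fun j => by induction j using Fin.addCases <;> simp [hm, hm'])
      (by simpa [Fin.sum_univ_add] using hle)
    simpa [Fin.sum_univ_add] using key
  · intro hadd n t m hm hpos
    rcases Nat.eq_zero_or_pos n with rfl | hn
    · simp
    have hneg := sum_nonneg n (fun j => (t j)⁻) m (fun j => negPart_nonneg _) hm
    have hle : ∑ j, (t j)⁻ • m j ≤ ∑ j, (t j)⁺ • m j := by
      rw [← sub_nonneg, ← Finset.sum_sub_distrib]
      simpa only [← sub_smul, posPart_sub_negPart] using hpos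
    have hp : pM M (∑ j, (t j)⁻ • m j) ≤ ∑ j, (t j)⁺ := by
      refine csInf_le ⟨0, ?_⟩ ⟨n, fun j => (t j)⁺, m, hn, fun j => posPart_nonneg _, hm,
        (neg_nonpos.2 hneg).trans (hneg.trans hle), hle, rfl⟩
      rintro _ ⟨k, s, m', -, hs, -, -, -, rfl⟩
      exact Finset.sum_nonneg fun j _ => hs j
    rw [hadd n (fun j => (t j)⁻) m hn (fun j => negPart_nonneg _) hm, ← sub_nonneg,
      ← Finset.sum_sub_distrib] at hp
    simpa only [posPart_sub_negPart] using hp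
end
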